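/- Let A be the generator of a bounded C₀-group T with ‖T(t)‖ ≤ M, with σ(A) = {iλ_k : k ∈ ℤ, k ≠ 0} as in the spectral assumption, and let P_k be the associated Riesz projections. If Σ_{k ∈ ℤ, k ≠ 0} 1/|λ_k| < ∞, then for every x ∈ D(A²) the series Σ_{k ∈ ℤ, k ≠ 0} iλ_k P_k x converges and Σ_{k ∈ ℤ, k ≠ 0} iλ_k P_k x = Ax. -/

import Mathlib

open MeasureTheory Complex Filter Topology Metric

namespace SpectralDecomp

variable {G : Type*} [NormedAddCommGroup G] [NormedSpace ℂ G]

/-- `R` is the bounded inverse of `z • I - A`. -/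
structure ResolventAt (A : G →ₗ.[ℂ] G) (z : ℂ) (R : G →L[ℂ] G) : Prop where
  mem : ∀ y : G, R y ∈ A.domain
  solves : ∀ y : G, z • R y - A ⟨R y, mem y⟩ = y
  leftInv : ∀ x : A.domain, R (z • (x : G) - A x) = x

/-- The resolvent set of the (unbounded) operator `A`. -/
def resolventSet (A : G →ₗ.[ℂ] G) : Set ℂ :=
  {z : ℂ | ∃ R : G →L[ℂ] G, ResolventAt A z R}

/-- The spectrum of the (unbounded) operator `A`. -/
def spectrumSet (A : G →ₗ.[ℂ] G) : Set ℂ := (resolventSet A)ᶜ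

/-- Membership in the domain of `A ^ j`. -/
def InDomPow (A : G →ₗ.[ℂ] G) : ℕ → G → Prop
  | 0, _ => True
  | j + 1, x => ∃ h : x ∈ A.domain, InDomPow A j (A ⟨x, h⟩)

/-- The value `A ^ j x` for `x ∈ D(A ^ j)`. -/
noncomputable def powApply (A : G →ₗ.[ℂ] G) : (j : ℕ) → (x : G) → InDomPow A j x → G
  | 0, x, _ => x
  | j + 1, x, h => powApply A j (A ⟨x, h.choose⟩) h.choose_spec

/-- `A` generates an `n`-times integrated group `(Sp, Sm)` bounded by `M * (1 + |t| ^ m)`. -/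
def Generates (A : G →ₗ.[ℂ] G) (n m : ℕ) (M : ℝ) (Sp Sm : ℝ → G →L[ℂ] G) : Prop :=
  (∀ x : G, ContinuousOn (fun t : ℝ => Sp t x) (Set.Ici 0)) ∧
  (∀ x : G, ContinuousOn (fun t : ℝ => Sm t x) (Set.Ici 0)) ∧
  (∀ t : ℝ, 0 ≤ t → ‖Sp t‖ ≤ M * (1 + t ^ m)) ∧
  (∀ t : ℝ, 0 ≤ t → ‖Sm t‖ ≤ M * (1 + t ^ m)) ∧
  (∀ z : ℂ, 0 < z.re →
    (∃ R : G →L[ℂ] G, ResolventAt A z R ∧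
      ∀ x : G, R x = z ^ n • ∫ t in Set.Ioi (0 : ℝ), Complex.exp (-z * t) • Sp t x) ∧
    (∃ R : G →L[ℂ] G, ResolventAt A (-z) R ∧
      ∀ x : G, -(R x) = z ^ n • ∫ t in Set.Ioi (0 : ℝ), Complex.exp (-z * t) • Sm t x))

/-- The Riesz projection associated to the circle of centre `c` and radius `ρ`,
built from the resolvent function `Rres`. -/
noncomputable def rieszProj (Rres : ℂ → G →L[ℂ] G) (c : ℂ) (ρ : ℝ) : G →L[ℂ] G :=
  (2 * Real.pi * Complex.I)⁻¹ • (∮ z in C(c, ρ), Rres z)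

section Analytic

variable {F : Type*} [NormedAddCommGroup F] [NormedSpace ℂ F]

/-- On a circle centred on the imaginary axis, `(z - d) ^ 2 + ρ ^ 2` vanishes like `Re z`. -/
theorem norm_sq_add_sq_of_mem_sphere {d z : ℂ} {ρ : ℝ} (hd : d.re = 0) (hz : ‖z - d‖ = ρ) :
    ‖(z - d) ^ 2 + (ρ : ℂ) ^ 2‖ = 2 * ρ * |z.re| := by
  have h : (z - d) ^ 2 + (ρ : ℂ) ^ 2 = (z - d) * ((2 * z.re : ℝ) : ℂ) := by
    have h1 : (ρ : ℂ) ^ 2 = (z - d) * (starRingEnd ℂ) (z - d) := by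
      rw [Complex.mul_conj, Complex.normSq_eq_norm_sq, hz]; push_cast; rfl
    have h2 : ((2 * z.re : ℝ) : ℂ) = (z - d) + (starRingEnd ℂ) (z - d) := by
      rw [Complex.add_conj]; simp [hd]
    rw [h1, h2]; ring
  rw [h, norm_mul, hz, Complex.norm_real, Real.norm_eq_abs, abs_mul, abs_two]
  ring

/-- A holomorphic function bounded by `C / |Re z|` on a disc centred on the imaginary axis is
bounded by `4 * C / ρ` on the concentric disc of half the radius. -/
theorem norm_le_of_norm_mul_abs_re_le {f : ℂ → F} {C ρ : ℝ} {d : ℂ} (hρ : 0 < ρ)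
    (hd : d.re = 0) (hf : ∀ z ∈ closedBall d ρ, DifferentiableAt ℂ f z)
    (hC : ∀ z, ‖f z‖ * |z.re| ≤ C) {z : ℂ} (hz : ‖z - d‖ ≤ ρ / 2) :
    ‖f z‖ ≤ 4 * C / ρ := by
  have hC0 : 0 ≤ C := le_trans (by positivity) (hC z)
  have hmax : ‖((z - d) ^ 2 + (ρ : ℂ) ^ 2) • f z‖ ≤ 2 * ρ * C := by
    refine Complex.norm_le_of_forall_mem_frontier_norm_le (U := ball d ρ)
      (f := fun z => ((z - d) ^ 2 + (ρ : ℂ) ^ 2) • f z) isBounded_ball ?_ ?_ ?_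
    · apply DifferentiableOn.diffContOnCl
      rw [closure_ball d hρ.ne']
      intro w hw
      have := hf w hw
      apply DifferentiableAt.differentiableWithinAt
      fun_prop
    · intro w hw
      rw [frontier_ball d hρ.ne', mem_sphere_iff_norm] at hw
      rw [norm_smul, norm_sq_add_sq_of_mem_sphere hd hw]
      have := hC w
      nlinarith
    · apply subset_closure
      rw [mem_ball_iff_norm]
      linarith
  have hlow : ρ ^ 2 / 2 ≤ ‖(z - d) ^ 2 + (ρ : ℂ) ^ 2‖ := by
    have h1 : ‖(ρ : ℂ) ^ 2‖ ≤ ‖(z - d) ^ 2 + (ρ : ℂ) ^ 2‖ + ‖(z - d) ^ 2‖ := by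
      have := norm_sub_le ((z - d) ^ 2 + (ρ : ℂ) ^ 2) ((z - d) ^ 2)
      simpa using this
    rw [norm_pow, norm_pow, Complex.norm_real, Real.norm_eq_abs, sq_abs] at h1
    nlinarith [norm_nonneg (z - d)]
  rw [norm_smul] at hmax
  rw [le_div_iff₀ hρ]
  have h3 : ρ ^ 2 / 2 * ‖f z‖ ≤ 2 * ρ * C :=
    le_trans (mul_le_mul_of_nonneg_right hlow (norm_nonneg _)) hmax
  nlinarith

/-- An isolated singularity on the imaginary axis of a function bounded by `C / |Re z|` is at
most a simple pole. -/
theorem exists_tendsto_sub_smul [CompleteSpace F] {f : ℂ → F} {C ρ : ℝ} {c : ℂ} (hρ : 0 < ρ)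
    (hc : c.re = 0) (hf : ∀ z ∈ closedBall c ρ \ {c}, DifferentiableAt ℂ f z)
    (hC : ∀ z, ‖f z‖ * |z.re| ≤ C) :
    ∃ P : F, Tendsto (fun z => (z - c) • f z) (𝓝[≠] c) (𝓝 P) := by
  have hC0 : 0 ≤ C := le_trans (by positivity) (hC 0)
  refine ⟨_, Complex.tendsto_limUnder_of_differentiable_on_punctured_nhds_of_bounded_under ?_ ?_⟩
  · filter_upwards [sdiff_mem_nhdsWithin_compl (closedBall_mem_nhds c hρ) {c}] with z hz
    have := hf z hz
    fun_prop
  · refine ⟨16 * C, ?_⟩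
    rw [eventually_map]
    filter_upwards [sdiff_mem_nhdsWithin_compl (closedBall_mem_nhds c (half_pos hρ)) {c}]
      with z hz
    have hzc : ‖z - c‖ ≤ ρ / 2 := mem_closedBall_iff_norm.1 hz.1
    have hre : (z - c).re = z.re := by simp [hc]
    have hnorm : ‖z - c‖ ≤ |z.re| + |(z - c).im| := by
      rw [← hre]; exact Complex.norm_le_abs_re_add_abs_im _
    simp only [sub_self, zero_smul, sub_zero, norm_smul]
    rcases le_total |(z - c).im| (4 * |z.re|) with h | h
    · have := hC z
      nlinarith [norm_nonneg (f z)]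
    · set d : ℂ := c + ((z - c).im : ℂ) * I with hd
      have him : |(z - c).im| ≤ ρ / 2 := (Complex.abs_im_le_norm _).trans hzc
      have hdc : ‖d - c‖ = |(z - c).im| := by
        simp [hd, -Complex.sub_im]
      have hne : 0 < |(z - c).im| := by
        rcases (abs_nonneg (z - c).im).eq_or_lt with h0 | h0
        · exfalso
          have h1 : ‖z - c‖ ≤ 0 := by linarith
          exact hz.2 (sub_eq_zero.1 (norm_le_zero_iff.1 h1))
        · exact h0
      have hzd : ‖z - d‖ = |z.re| := by
        have : z - d = (z.re : ℂ) := by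
          apply Complex.ext <;> simp [hd, hc]
        rw [this, Complex.norm_real, Real.norm_eq_abs]
      have key := norm_le_of_norm_mul_abs_re_le (f := f) (C := C) (d := d) (z := z)
        (half_pos hne) (by simp [hd, hc]) (fun w hw => hf w ⟨?_, ?_⟩) hC (by rw [hzd]; linarith)
      · rw [le_div_iff₀ (half_pos hne)] at key
        nlinarith [norm_nonneg (f z)]
      · rw [mem_closedBall_iff_norm] at hw ⊢
        have := norm_add_le (w - d) (d - c)
        rw [sub_add_sub_cancel] at this
        linarith
      · rintro rfl
        rw [mem_closedBall_iff_norm, norm_sub_rev, hdc] at hw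
        linarith

/-- A function bounded by `C / |Re z|` all of whose singularities are removable vanishes. -/
theorem eq_zero_of_norm_mul_abs_re_le [CompleteSpace F] {f : ℂ → F} {C : ℝ}
    (hf : ∀ c, ∀ᶠ z in 𝓝[≠] c, DifferentiableAt ℂ f z)
    (hlim : ∀ c, Tendsto (fun z => (z - c) • f z) (𝓝[≠] c) (𝓝 0))
    (hC : ∀ z, ‖f z‖ * |z.re| ≤ C) (hre : ∀ z : ℂ, z.re ≠ 0 → DifferentiableAt ℂ f z)
    {z : ℂ} (hz : DifferentiableAt ℂ f z) : f z = 0 := by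
  set g : ℂ → F := fun z => limUnder (𝓝[≠] z) f with hg
  have hgf : ∀ w, DifferentiableAt ℂ f w → g w = f w := fun w hw =>
    (hw.continuousAt.tendsto.mono_left nhdsWithin_le_nhds).limUnder_eq
  have hgd : Differentiable ℂ g := by
    intro c
    have hs : {z | DifferentiableAt ℂ f z} ∈ 𝓝[≠] c := hf c
    have hins : insert c {z | DifferentiableAt ℂ f z} ∈ 𝓝 c := insert_mem_nhds_iff.2 hs
    have hupd := (Complex.differentiableOn_update_limUnder_insert_of_isLittleO hs
      (fun z hz => hz.differentiableWithinAt) (by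
        have h0 : Tendsto (fun z => (z - c) • f c) (𝓝[≠] c) (𝓝 0) := by
          have : ContinuousAt (fun z : ℂ => (z - c) • f c) c := by fun_prop
          simpa using this.tendsto.mono_left nhdsWithin_le_nhds
        have h1 := (hlim c).sub h0
        rw [sub_zero] at h1
        rw [Asymptotics.isLittleO_iff]
        intro ε hε
        filter_upwards [(Metric.tendsto_nhds.1 h1) ε hε, self_mem_nhdsWithin] with z hz hzc
        have hpos : 0 < ‖z - c‖ := norm_pos_iff.2 (sub_ne_zero.2 hzc)
        rw [← smul_sub, dist_zero_right, norm_smul] at hz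
        rw [norm_inv, ← div_eq_mul_inv, le_div_iff₀ hpos]
        linarith)).differentiableAt hins
    refine hupd.congr_of_eventuallyEq ?_
    filter_upwards [hins] with w hw
    rcases eq_or_ne w c with rfl | hwc
    · simp [hg]
    · rw [Function.update_of_ne hwc]
      exact hgf w (hw.resolve_left hwc)
  have hgC : ∀ w, ‖g w‖ * |w.re| ≤ C := by
    intro w
    by_cases hw : w.re = 0
    · have := hC 0
      simpa [hw] using this
    · rw [hgf w (hre w hw)]
      exact hC w
  rw [← hgf z hz, ← norm_le_zero_iff]
  have hlim0 : Tendsto (fun ρ : ℝ => 4 * C / ρ) atTop (𝓝 0) :=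
    tendsto_const_nhds.div_atTop tendsto_id
  refine ge_of_tendsto hlim0 ?_
  filter_upwards [eventually_gt_atTop 0, eventually_ge_atTop (2 * ‖z‖)] with ρ h0 h1
  exact norm_le_of_norm_mul_abs_re_le h0 (d := 0) (by simp) (fun w _ => hgd w) hgC
    (by rw [sub_zero]; linarith)

end Analytic

section Semigroup

variable {E : Type*} [NormedAddCommGroup E] [NormedSpace ℂ E]

/-- A bounded curve `φ` with `‖z φ - φ'‖ ≤ C₁` satisfies `‖φ 0‖ ≤ C₁ / Re z`. -/
theorem norm_mul_re_le_of_hasDerivAt {φ φ' : ℝ → E} {z : ℂ} {C₀ C₁ : ℝ} (hz : 0 < z.re)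
    (hφ : ∀ t, HasDerivAt φ (φ' t) t) (h₀ : ∀ t, ‖φ t‖ ≤ C₀)
    (h₁ : ∀ t, ‖z • φ t - φ' t‖ ≤ C₁) : ‖φ 0‖ * z.re ≤ C₁ := by
  have hexp : ∀ t : ℝ, HasDerivAt (fun t : ℝ => Complex.exp (-z * t))
      (Complex.exp (-z * t) * -z) t := by
    intro t
    have h := ((hasDerivAt_id (t : ℂ)).const_mul (-z)).cexp.comp_ofReal
    simpa using h
  have hnexp : ∀ t : ℝ, ‖Complex.exp (-z * t)‖ = Real.exp (-z.re * t) := by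
    intro t
    rw [Complex.norm_exp]; simp
  have hu : ∀ t : ℝ, HasDerivAt (fun t : ℝ => φ 0 - Complex.exp (-z * t) • φ t)
      (Complex.exp (-z * t) • (z • φ t - φ' t)) t := by
    intro t
    refine (((hexp t).smul (hφ t)).const_sub (φ 0)).congr_deriv ?_
    module
  have hB : ∀ t : ℝ, HasDerivAt (fun t : ℝ => C₁ / z.re * (1 - Real.exp (-z.re * t)))
      (C₁ * Real.exp (-z.re * t)) t := by
    intro t
    have h := ((((hasDerivAt_id t).const_mul (-z.re)).exp).const_sub 1).const_mul (C₁ / z.re)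
    refine h.congr_deriv ?_
    simp only [id]
    field_simp
  have hbound : ∀ t : ℝ, 0 ≤ t →
      ‖φ 0 - Complex.exp (-z * t) • φ t‖ ≤ C₁ / z.re * (1 - Real.exp (-z.re * t)) := by
    intro t ht
    refine image_norm_le_of_norm_deriv_right_le_deriv_boundary (a := 0) (b := t)
      (fun s _ => (hu s).continuousAt.continuousWithinAt)
      (fun s _ => (hu s).hasDerivWithinAt) (by simp) hB ?_ ⟨ht, le_rfl⟩
    intro s _
    rw [norm_smul, hnexp, mul_comm C₁]
    exact mul_le_mul_of_nonneg_left (h₁ s) (Real.exp_pos _).le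
  have hE : Tendsto (fun t : ℝ => Real.exp (-z.re * t)) atTop (𝓝 0) := by
    refine Real.tendsto_exp_atBot.comp ?_
    exact tendsto_id.const_mul_atTop_of_neg (by linarith)
  have hlim : Tendsto (fun t : ℝ => C₁ / z.re * (1 - Real.exp (-z.re * t))
      + Real.exp (-z.re * t) * C₀) atTop (𝓝 (C₁ / z.re)) := by
    have := ((hE.const_sub 1).const_mul (C₁ / z.re)).add (hE.mul_const C₀)
    simpa using this
  rw [← le_div_iff₀ hz]
  refine ge_of_tendsto hlim ?_
  filter_upwards [eventually_ge_atTop 0] with t ht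
  have h := norm_add_le (φ 0 - Complex.exp (-z * t) • φ t) (Complex.exp (-z * t) • φ t)
  rw [sub_add_cancel, norm_smul (Complex.exp _), hnexp] at h
  have := mul_le_mul_of_nonneg_left (h₀ t) (Real.exp_pos (-z.re * t)).le
  linarith [hbound t ht]

theorem hasDerivAt_orbit {T : ℝ → E →L[ℂ] E} (hTmul : ∀ s t : ℝ, T (s + t) = T s ∘L T t)
    {x y : E}
    (hxy : Tendsto (fun t : ℝ => ((t : ℂ))⁻¹ • (T t x - x)) (𝓝[≠] 0) (𝓝 y)) (t : ℝ) :
    HasDerivAt (fun s => T s x) (T t y) t := by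
  rw [hasDerivAt_iff_tendsto_slope_zero]
  refine (((T t).continuous.tendsto y).comp hxy).congr fun s => ?_
  simp only [Function.comp_apply, map_smul, map_sub, hTmul, ContinuousLinearMap.comp_apply]
  rw [← Complex.ofReal_inv, Complex.coe_smul]

/-- The Hille–Yosida estimate for the generator of a bounded group. -/
theorem norm_mul_abs_re_le {T : ℝ → E →L[ℂ] E} {M : ℝ} (hT0 : T 0 = 1)
    (hTmul : ∀ s t : ℝ, T (s + t) = T s ∘L T t) (hTbd : ∀ t : ℝ, ‖T t‖ ≤ M) {x y : E}
    (hxy : Tendsto (fun t : ℝ => ((t : ℂ))⁻¹ • (T t x - x)) (𝓝[≠] 0) (𝓝 y)) (z : ℂ) :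
    ‖x‖ * |z.re| ≤ M * ‖z • x - y‖ := by
  have hb : ∀ t w, ‖T t w‖ ≤ M * ‖w‖ := fun t w => (T t).le_of_opNorm_le (hTbd t) w
  have hM : 0 ≤ M := (norm_nonneg _).trans (hTbd 0)
  have hder := hasDerivAt_orbit hTmul hxy
  rcases lt_trichotomy z.re 0 with hz | hz | hz
  · have h := norm_mul_re_le_of_hasDerivAt (φ := fun t => T (-t) x) (φ' := fun t => -T (-t) y)
      (z := -z) (C₀ := M * ‖x‖) (C₁ := M * ‖z • x - y‖) (by simpa using hz)
      (fun t => by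
        have h := (hder (-t)).scomp t (hasDerivAt_neg t)
        simpa [Function.comp_def] using h)
      (fun t => hb _ _)
      (fun t => by
        have h : -z • T (-t) x - -T (-t) y = -T (-t) (z • x - y) := by
          rw [map_sub, map_smul]; module
        rw [h, norm_neg]; exact hb _ _)
    simpa [hT0, abs_of_neg hz] using h
  · rw [hz, abs_zero, mul_zero]; positivity
  · have h := norm_mul_re_le_of_hasDerivAt (φ := fun t => T t x) (φ' := fun t => T t y)
      (z := z) (C₀ := M * ‖x‖) (C₁ := M * ‖z • x - y‖) hz hder (fun t => hb _ _)
      (fun t => by rw [← map_smul, ← map_sub]; exact hb _ _)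
    simpa [hT0, abs_of_pos hz] using h

end Semigroup

section Resolvent

variable {A : G →ₗ.[ℂ] G} {z w : ℂ} {R S : G →L[ℂ] G}

theorem ResolventAt.unique (hR : ResolventAt A z R) (hS : ResolventAt A z S) : R = S := by
  ext y
  have h := hS.leftInv ⟨R y, hR.mem y⟩
  rw [hR.solves] at h
  exact h.symm

/-- The resolvent identity. -/
theorem ResolventAt.sub_eq (hR : ResolventAt A z R) (hS : ResolventAt A w S) :
    R - S = (w - z) • (S * R) := by
  ext y
  have h := hS.leftInv ⟨R y, hR.mem y⟩
  have h2 : w • R y - A ⟨R y, hR.mem y⟩ = (w - z) • R y + y := by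
    linear_combination (norm := module) hR.solves y
  simp only [h2, map_add, map_smul] at h
  change R y - S y = (w - z) • S (R y)
  exact sub_eq_of_eq_add h.symm

theorem ResolventAt.mul_inverse (hS : ResolventAt A w S) (hu : IsUnit (1 + (z - w) • S)) :
    ResolventAt A z (S * Ring.inverse (1 + (z - w) • S)) := by
  set V := Ring.inverse (1 + (z - w) • S)
  have hUV : (1 + (z - w) • S) * V = 1 := Ring.mul_inverse_cancel _ hu
  have hVU : V * (1 + (z - w) • S) = 1 := Ring.inverse_mul_cancel _ hu
  have hcomm : S * V = V * S := by
    calc S * V = (V * (1 + (z - w) • S)) * (S * V) := by rw [hVU, one_mul]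
      _ = V * (S * ((1 + (z - w) • S) * V)) := by
        simp only [mul_assoc, add_mul, mul_add, one_mul, smul_mul_assoc, mul_smul_comm]
      _ = V * S := by rw [hUV, mul_one]
  refine ⟨fun y => hS.mem _, fun y => ?_, fun x => ?_⟩
  · have h := hS.solves (V y)
    have h2 : V y + (z - w) • S (V y) = y := by
      simpa using congrArg (fun L : G →L[ℂ] G => L y) hUV
    change z • S (V y) - A ⟨S (V y), hS.mem _⟩ = y
    linear_combination (norm := module) h + h2
  · rw [hcomm]
    change V (S (z • (x : G) - A x)) = x
    have h := hS.leftInv x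
    have h2 : z • (x : G) - A x = (w • (x : G) - A x) + (z - w) • (x : G) := by module
    rw [h2, map_add, map_smul, h]
    simpa using congrArg (fun L : G →L[ℂ] G => L (x : G)) hVU

variable [CompleteSpace G]

theorem eventually_resolventAt_mul_inverse (hS : ResolventAt A w S) :
    ∀ᶠ z in 𝓝 w, ResolventAt A z (S * Ring.inverse (1 + (z - w) • S)) := by
  have hcont : ContinuousAt (fun z : ℂ => 1 + (z - w) • S) w := by fun_prop
  have hmem : {U : G →L[ℂ] G | IsUnit U} ∈ 𝓝 (1 + (w - w) • S) :=
    Units.isOpen.mem_nhds (by simp)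
  filter_upwards [hcont.preimage_mem_nhds hmem] with z hz
  exact hS.mul_inverse hz

theorem isOpen_resolventSet : IsOpen (resolventSet A) := by
  rw [isOpen_iff_mem_nhds]
  rintro w ⟨S, hS⟩
  filter_upwards [eventually_resolventAt_mul_inverse hS] with z hz
  exact ⟨_, hz⟩

theorem differentiableAt_resolvent {Rres : ℂ → G →L[ℂ] G}
    (hres : ∀ z ∈ resolventSet A, ResolventAt A z (Rres z)) (hw : w ∈ resolventSet A) :
    DifferentiableAt ℂ Rres w := by
  have hS := hres w hw
  have hd : DifferentiableAt ℂ (fun z : ℂ => Rres w * Ring.inverse (1 + (z - w) • Rres w)) w := by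
    refine DifferentiableAt.const_mul ?_ _
    refine DifferentiableAt.comp (g := Ring.inverse) w (differentiableAt_inverse ?_) (by fun_prop)
    simp
  refine hd.congr_of_eventuallyEq ?_
  filter_upwards [eventually_resolventAt_mul_inverse hS] with z hz
  exact (hres z ⟨_, hz⟩).unique hz

end Resolvent

section Residue

variable {A : G →ₗ.[ℂ] G} {Rres : ℂ → G →L[ℂ] G} {c : ℂ} {P : G →L[ℂ] G}

/-- The residue of the resolvent at a simple pole `c` intertwines `A` with multiplication by
`c`. -/
theorem residue_apply_generator (hP : Tendsto (fun z => (z - c) • Rres z) (𝓝[≠] c) (𝓝 P))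
    (hres : ∀ᶠ z in 𝓝[≠] c, ResolventAt A z (Rres z)) (x : A.domain) :
    P (A x) = c • P x := by
  have hz : Tendsto (fun z : ℂ => z) (𝓝[≠] c) (𝓝 c) := nhdsWithin_le_nhds
  have hPv : ∀ v, Tendsto (fun z => (z - c) • Rres z v) (𝓝[≠] c) (𝓝 (P v)) := fun v =>
    ((ContinuousLinearMap.apply ℂ G v).continuous.tendsto P).comp hP
  have hleft : Tendsto (fun z => (z - c) • Rres z (A x)) (𝓝[≠] c) (𝓝 (c • P x)) := by
    have h := (hz.smul (hPv x)).sub ((hz.sub_const c).smul_const (x : G))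
    rw [sub_self, zero_smul, sub_zero] at h
    refine h.congr' ?_
    filter_upwards [hres] with z hR
    have h := hR.leftInv x
    rw [map_sub, map_smul] at h
    linear_combination (norm := module) (z - c) • h
  exact tendsto_nhds_unique (hPv _) hleft

theorem norm_residue_le (hP : Tendsto (fun z => (z - c) • Rres z) (𝓝[≠] c) (𝓝 P))
    (hc : c.re = 0) {M : ℝ} (hM : ∀ z, ‖Rres z‖ * |z.re| ≤ M) : ‖P‖ ≤ M := by
  have hpath : Tendsto (fun t : ℝ => c + t) (𝓝[≠] 0) (𝓝[≠] c) := by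
    refine tendsto_nhdsWithin_iff.2 ⟨?_, ?_⟩
    · have : ContinuousAt (fun t : ℝ => c + t) 0 := by fun_prop
      simpa using this.tendsto.mono_left nhdsWithin_le_nhds
    · filter_upwards [self_mem_nhdsWithin] with t ht
      simpa using ht
  refine le_of_tendsto (hP.comp hpath).norm (Eventually.of_forall fun t => ?_)
  have h := hM (c + t)
  simp only [Complex.add_re, hc, Complex.ofReal_re, zero_add] at h
  simpa [norm_smul, mul_comm] using h

theorem resolvent_mul_residue (hP : Tendsto (fun z => (z - c) • Rres z) (𝓝[≠] c) (𝓝 P))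
    (hres : ∀ᶠ z in 𝓝[≠] c, ResolventAt A z (Rres z)) {w : ℂ} {S : G →L[ℂ] G}
    (hS : ResolventAt A w S) : (w - c) • (S * P) = P := by
  have hz : Tendsto (fun z : ℂ => z) (𝓝[≠] c) (𝓝 c) := nhdsWithin_le_nhds
  have h1 : Tendsto (fun z => (w - z) • (S * ((z - c) • Rres z))) (𝓝[≠] c)
      (𝓝 ((w - c) • (S * P))) := (hz.const_sub w).smul (hP.const_mul S)
  have h2 : Tendsto (fun z => (z - c) • Rres z - (z - c) • S) (𝓝[≠] c) (𝓝 P) := by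
    have h := hP.sub ((hz.sub_const c).smul_const S)
    rwa [sub_self, zero_smul, sub_zero] at h
  refine tendsto_nhds_unique h1 (h2.congr' ?_)
  filter_upwards [hres] with z hR
  rw [mul_smul_comm, smul_comm, ← hR.sub_eq hS, smul_sub]

/-- The residues at distinct simple poles annihilate each other. -/
theorem residue_mul_residue_of_ne {c' : ℂ} {P' : G →L[ℂ] G}
    (hP : Tendsto (fun z => (z - c) • Rres z) (𝓝[≠] c) (𝓝 P))
    (hP' : Tendsto (fun z => (z - c') • Rres z) (𝓝[≠] c') (𝓝 P'))
    (hres : ∀ᶠ z in 𝓝[≠] c, ResolventAt A z (Rres z))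
    (hres' : ∀ᶠ z in 𝓝[≠] c', ResolventAt A z (Rres z)) (hne : c ≠ c') : P * P' = 0 := by
  have hz : Tendsto (fun z : ℂ => z) (𝓝[≠] c) (𝓝 c) := nhdsWithin_le_nhds
  have h1 : Tendsto (fun z => (z - c') • ((z - c) • Rres z * P')) (𝓝[≠] c)
      (𝓝 ((c - c') • (P * P'))) := (hz.sub_const c').smul (hP.mul_const P')
  have h2 : Tendsto (fun z => (z - c) • P') (𝓝[≠] c) (𝓝 0) := by
    have h := (hz.sub_const c).smul_const P'
    rwa [sub_self, zero_smul] at h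
  have h3 := tendsto_nhds_unique h1 (h2.congr' (by
    filter_upwards [hres] with z hR
    rw [smul_mul_assoc, smul_comm, resolvent_mul_residue hP' hres' hR]))
  exact (smul_eq_zero.1 h3).resolve_left (sub_ne_zero.2 hne)

/-- The residue at a simple pole is idempotent. -/
theorem residue_mul_self (hP : Tendsto (fun z => (z - c) • Rres z) (𝓝[≠] c) (𝓝 P))
    (hres : ∀ᶠ z in 𝓝[≠] c, ResolventAt A z (Rres z)) : P * P = P := by
  refine tendsto_nhds_unique (hP.mul_const P) (tendsto_const_nhds.congr' ?_)
  filter_upwards [hres] with z hR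
  rw [smul_mul_assoc, resolvent_mul_residue hP hres hR]

end Residue

theorem tendsto_sub_smul_rieszProj [CompleteSpace G] {f : ℂ → G →L[ℂ] G} {C ρ : ℝ} {c : ℂ}
    (hρ : 0 < ρ) (hc : c.re = 0) (hf : ∀ z ∈ closedBall c ρ \ {c}, DifferentiableAt ℂ f z)
    (hC : ∀ z, ‖f z‖ * |z.re| ≤ C) :
    Tendsto (fun z => (z - c) • f z) (𝓝[≠] c) (𝓝 (rieszProj f c ρ)) := by
  obtain ⟨P, hP⟩ := exists_tendsto_sub_smul hρ hc hf hC
  have hd : ∀ z ∈ closedBall c ρ \ {c}, DifferentiableAt ℂ (fun z => (z - c) • f z) z := by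
    intro z hz
    have := hf z hz
    fun_prop
  have h := circleIntegral_sub_center_inv_smul_of_differentiable_on_off_countable_of_tendsto
    hρ Set.countable_empty (fun z hz => (hd z hz).continuousAt.continuousWithinAt)
    (fun z hz => hd z ⟨ball_subset_closedBall hz.1.1, hz.1.2⟩) hP
  have h2 : (∮ z in C(c, ρ), (z - c)⁻¹ • (z - c) • f z) = ∮ z in C(c, ρ), f z := by
    refine circleIntegral.integral_congr hρ.le fun z hz => ?_
    have hne : z - c ≠ 0 := sub_ne_zero.2 (ne_of_mem_sphere hz hρ.ne')
    simp only [inv_smul_smul₀ hne]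
  rw [h2] at h
  rwa [rieszProj, h, inv_smul_smul₀ Complex.two_pi_I_ne_zero]

/-- If `A` generates the bounded `C₀`-group `T` with `‖T t‖ ≤ M`, with discrete
spectrum `σ(A) = {iλ_k : k ∈ ℤ, k ≠ 0}` as in the spectral assumption, and
`Σ_{k ≠ 0} 1 / |λ_k| < ∞`, then for every `x ∈ D(A²)` the series
`Σ_k iλ_k P_k x` converges and sums to `A x`. -/
theorem spectral_decomposition_Ax_bounded_group
    {E : Type*} [NormedAddCommGroup E] [NormedSpace ℂ E] [CompleteSpace E]
    (T : ℝ → E →L[ℂ] E) (M : ℝ)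
    (hT0 : T 0 = 1) (hTmul : ∀ s t : ℝ, T (s + t) = T s ∘L T t)
    (hTcont : ∀ x : E, Continuous fun t : ℝ => T t x)
    (hTbd : ∀ t : ℝ, ‖T t‖ ≤ M)
    (A : E →ₗ.[ℂ] E)
    (hgen : ∀ x y : E, (∃ hx : x ∈ A.domain, A ⟨x, hx⟩ = y) ↔
      Filter.Tendsto (fun t : ℝ => ((t : ℂ))⁻¹ • (T t x - x))
        (nhdsWithin 0 {(0 : ℝ)}ᶜ) (nhds y))
    (Rres : ℂ → E →L[ℂ] E)
    (hres : ∀ z ∈ resolventSet A, ResolventAt A z (Rres z))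
    (lam : ℤ → ℝ)
    (hmono : ∀ j k : ℤ, j ≠ 0 → k ≠ 0 → j < k → lam j < lam k)
    (hpos : ∀ k : ℤ, 0 < k → 0 < lam k)
    (hneg : ∀ k : ℤ, k < 0 → lam k < 0)
    (hspec : spectrumSet A = {z : ℂ | ∃ k : ℤ, k ≠ 0 ∧ z = Complex.I * (lam k : ℂ)})
    (r : ℤ → ℝ) (hrpos : ∀ k : ℤ, k ≠ 0 → 0 < r k)
    (hrsep : ∀ k : ℤ, k ≠ 0 → ∀ z ∈ spectrumSet A,
      z ∈ Metric.closedBall (Complex.I * (lam k : ℂ)) (r k) → z = Complex.I * (lam k : ℂ))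
    (hsum : Summable (fun k : {k : ℤ // k ≠ 0} => 1 / |lam k.1|))
    (x : E) (hx : x ∈ A.domain) (hx2 : A ⟨x, hx⟩ ∈ A.domain) :
    HasSum (fun k : {k : ℤ // k ≠ 0} =>
      (Complex.I * (lam k.1 : ℂ)) • rieszProj Rres (Complex.I * (lam k.1 : ℂ)) (r k.1) x)
      (A ⟨x, hx⟩) := by
  set ι := {k : ℤ // k ≠ 0}
  set c : ι → ℂ := fun k => Complex.I * (lam k.1 : ℂ) with hc
  set P : ι → E →L[ℂ] E := fun k => rieszProj Rres (c k) (r k.1)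
  have hc_re : ∀ k, (c k).re = 0 := fun k => by simp [hc]
  have hlam_ne : ∀ k : ι, lam k.1 ≠ 0 := fun k => by
    rcases lt_or_gt_of_ne k.2 with h | h
    · exact (hneg _ h).ne
    · exact (hpos _ h).ne'
  have hc_inj : ∀ j k : ι, j ≠ k → c j ≠ c k := by
    intro j k hjk h
    have h1 : lam j.1 = lam k.1 := by
      simpa [hc] using h
    rcases lt_or_gt_of_ne (fun h => hjk (Subtype.ext h) : j.1 ≠ k.1) with h2 | h2
    · exact (hmono _ _ j.2 k.2 h2).ne h1
    · exact (hmono _ _ k.2 j.2 h2).ne' h1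
  have hres_of_re : ∀ z : ℂ, z.re ≠ 0 → z ∈ resolventSet A := by
    intro z hz
    by_contra hmem
    have h : z ∈ spectrumSet A := hmem
    rw [hspec] at h
    obtain ⟨k, -, rfl⟩ := h
    simp at hz
  have hM : 0 ≤ M := (norm_nonneg _).trans (hTbd 0)
  have hbound : ∀ z, ‖Rres z‖ * |z.re| ≤ M := by
    intro z
    rcases eq_or_ne z.re 0 with hz | hz
    · simpa [hz] using hM
    · have hR := hres z (hres_of_re z hz)
      have hz' : 0 < |z.re| := abs_pos.2 hz
      rw [← le_div_iff₀ hz']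
      refine ContinuousLinearMap.opNorm_le_bound _ (by positivity) fun y => ?_
      have h := norm_mul_abs_re_le hT0 hTmul hTbd ((hgen _ _).1 ⟨hR.mem y, rfl⟩) z
      rw [hR.solves] at h
      rw [div_mul_eq_mul_div, le_div_iff₀ hz']
      exact h
  have hball : ∀ (k : ι), ∀ z ∈ closedBall (c k) (r k.1) \ {c k}, z ∈ resolventSet A := by
    intro k z hz
    by_contra hmem
    exact hz.2 (hrsep k.1 k.2 z hmem hz.1)
  have hdiff : ∀ z ∈ resolventSet A, DifferentiableAt ℂ Rres z := fun z hz =>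
    differentiableAt_resolvent hres hz
  have hpunct : ∀ k, ∀ᶠ z in 𝓝[≠] (c k), z ∈ resolventSet A := by
    intro k
    filter_upwards [sdiff_mem_nhdsWithin_compl (closedBall_mem_nhds (c k) (hrpos k.1 k.2)) {c k}]
      with z hz using hball k z hz
  have hresP : ∀ k, ∀ᶠ z in 𝓝[≠] (c k), ResolventAt A z (Rres z) := fun k =>
    (hpunct k).mono hres
  have hP : ∀ k, Tendsto (fun z => (z - c k) • Rres z) (𝓝[≠] (c k)) (𝓝 (P k)) := fun k =>
    tendsto_sub_smul_rieszProj (hrpos k.1 k.2) (hc_re k)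
      (fun z hz => hdiff z (hball k z hz)) hbound
  have hPA : ∀ k (v : A.domain), P k (A v) = c k • P k v := fun k v =>
    residue_apply_generator (hP k) (hresP k) v
  set a : E := A ⟨x, hx⟩
  have hterm : ∀ k, c k • P k x = P k a := fun k => (hPA k ⟨x, hx⟩).symm
  have hle : ∀ k, ‖P k a‖ ≤ M * ‖A ⟨a, hx2⟩‖ * (1 / |lam k.1|) := by
    intro k
    have h1 := congrArg norm (hPA k ⟨a, hx2⟩)
    have h2 : ‖c k‖ = |lam k.1| := by simp [hc]
    have h3 := (P k).le_of_opNorm_le (norm_residue_le (hP k) (hc_re k) hbound) (A ⟨a, hx2⟩)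
    rw [norm_smul, h2] at h1
    rw [mul_one_div, le_div_iff₀ (abs_pos.2 (hlam_ne k))]
    linarith
  have hsummable : Summable (fun k => P k a) :=
    Summable.of_norm_bounded (hsum.mul_left _) hle
  change HasSum (fun k => c k • P k x) a
  simp only [hterm]
  obtain ⟨y, hy⟩ := hsummable
  suffices hv : a - y = 0 by
    rwa [← sub_eq_zero.1 hv] at hy
  have hPv : ∀ j, P j (a - y) = 0 := by
    intro j
    have h1 : HasSum (fun k => P j (P k a)) (P j y) := hy.mapL (P j)
    have h2 : HasSum (fun k => P j (P k a)) (P j (P j a)) := by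
      refine hasSum_single j fun k hk => ?_
      exact congrArg (fun L : E →L[ℂ] E => L a) (residue_mul_residue_of_ne (hP j) (hP k)
        (hresP j) (hresP k) (hc_inj j k hk.symm))
    have h3 : P j (P j a) = P j a :=
      congrArg (fun L : E →L[ℂ] E => L a) (residue_mul_self (hP j) (hresP j))
    rw [map_sub, h1.unique h2, h3, sub_self]
  have happly : ∀ z ∈ resolventSet A, DifferentiableAt ℂ (fun z => Rres z (a - y)) z :=
    fun z hz => (hdiff z hz).clm_apply (differentiableAt_const _)
  have hcases : ∀ w, w ∈ resolventSet A ∨ ∃ k, w = c k := by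
    intro w
    by_cases hw : w ∈ resolventSet A
    · exact Or.inl hw
    · have h : w ∈ spectrumSet A := hw
      rw [hspec] at h
      obtain ⟨k, hk, rfl⟩ := h
      exact Or.inr ⟨⟨k, hk⟩, rfl⟩
  have hone : (1 : ℂ) ∈ resolventSet A := hres_of_re 1 (by simp)
  have hzero : Rres 1 (a - y) = 0 := by
    refine eq_zero_of_norm_mul_abs_re_le (f := fun z => Rres z (a - y)) (C := M * ‖a - y‖)
      ?_ ?_ ?_ (fun z hz => happly z (hres_of_re z hz)) (happly 1 hone)
    · intro w
      rcases hcases w with hw | ⟨k, rfl⟩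
      · exact nhdsWithin_le_nhds (mem_of_superset (isOpen_resolventSet.mem_nhds hw) happly)
      · exact (hpunct k).mono happly
    · intro w
      rcases hcases w with hw | ⟨k, rfl⟩
      · have h : ContinuousAt (fun z => (z - w) • Rres z (a - y)) w :=
          (continuousAt_id.sub continuousAt_const).smul (happly w hw).continuousAt
        simpa using h.tendsto.mono_left nhdsWithin_le_nhds
      · rw [← hPv k]
        exact ((ContinuousLinearMap.apply ℂ E (a - y)).continuous.tendsto (P k)).comp (hP k)
    · intro z
      have h := (Rres z).le_opNorm (a - y)
      have h2 := mul_le_mul_of_nonneg_right (hbound z) (norm_nonneg (a - y))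
      have h3 := mul_le_mul_of_nonneg_right h (abs_nonneg z.re)
      linarith
  have hsolve := (hres 1 hone).solves (a - y)
  have hA0 : A ⟨Rres 1 (a - y), (hres 1 hone).mem _⟩ = 0 := by
    rw [← map_zero A.toFun]
    exact congrArg A.toFun (Subtype.ext hzero)
  rw [hA0, hzero, smul_zero, sub_zero] at hsolve
  exact hsolve.symm

end SpectralDecomp
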